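/- Let N ≥ 1 be an integer, s < -1 and 1 ≤ p < ∞ with p > N. Then there is a constant C > 0 such that, for every R ≥ 0 and every locally absolutely continuous function f on (0,∞) with lim_{r→∞} f(r) = 0, sup_{r ≥ R} (1+r)^{-(s+1)} |f(r)| ≤ C (∫_R^∞ (1+r)^{-sp-N} r^{N-1} |f'(r)|^p dr)^{1/p}, with C independent of R and f. -/

import Mathlib

open MeasureTheory Metric Filter Topology ENNReal

noncomputable section

/-- Euclidean space `ℝ^N`. -/
abbrev Euc (N : ℕ) := EuclideanSpace ℝ (Fin N)

/-- Iterated classical partial derivative along a list of coordinate directions. -/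
def pderivList {N : ℕ} : List (Fin N) → (Euc N → ℝ) → Euc N → ℝ
  | [], φ => φ
  | i :: l, φ => pderivList l fun x => fderiv ℝ φ x (EuclideanSpace.single i 1)

/-- `g` is the weak (distributional) partial derivative of `u` of order given by the
list `l` of coordinate directions, i.e. `g = ∂_{l₁} ⋯ ∂_{l_r} u` in `D'(ℝ^N)`. -/
def IsWeakDerivList {N : ℕ} (l : List (Fin N)) (u g : Euc N → ℝ) : Prop :=
  LocallyIntegrable u volume ∧ LocallyIntegrable g volume ∧
    ∀ φ : Euc N → ℝ, ContDiff ℝ (⊤ : ℕ∞) φ → HasCompactSupport φ →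
      ∫ x, u x * pderivList l φ x = (-1 : ℝ) ^ l.length * ∫ x, g x * φ x

/-- `g` is the weak partial derivative `∂ᵢ u`. -/
def IsWeakPartialDeriv {N : ℕ} (i : Fin N) (u g : Euc N → ℝ) : Prop :=
  IsWeakDerivList [i] u g

/-- The weight `(1+|x|)^{-s-N/q}` of the space `L^q_s` (with `N/∞ := 0`). -/
def wt (N : ℕ) (s : ℝ) (q : ℝ≥0∞) (x : Euc N) : ℝ :=
  (1 + ‖x‖) ^ (-s - (N : ℝ) / q.toReal)

/-- Membership in the weighted space `L^q_s`. -/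
def MemLs (N : ℕ) (s : ℝ) (q : ℝ≥0∞) (u : Euc N → ℝ) : Prop :=
  MemLp (fun x => wt N s q x * u x) q volume

/-- The norm of the weighted space `L^q_s`. -/
def LsNorm (N : ℕ) (s : ℝ) (q : ℝ≥0∞) (u : Euc N → ℝ) : ℝ :=
  (eLpNorm (fun x => wt N s q x * u x) q volume).toReal

/-- Membership in the exponentially weighted space `L^q_{exp,s}`. -/
def MemLexp (N : ℕ) (s : ℝ) (q : ℝ≥0∞) (u : Euc N → ℝ) : Prop :=
  MemLp (fun x => Real.exp (-(s * ‖x‖)) * u x) q volume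

/-- The norm of the exponentially weighted space `L^q_{exp,s}`. -/
def LexpNorm (N : ℕ) (s : ℝ) (q : ℝ≥0∞) (u : Euc N → ℝ) : ℝ :=
  (eLpNorm (fun x => Real.exp (-(s * ‖x‖)) * u x) q volume).toReal

/-- The pointwise Euclidean (Frobenius) norm `|∇^k u|` of the `k`-th gradient, whose
components `g m` are indexed by the `k`-tuples `m` of coordinate directions. -/
def gradNormK {N k : ℕ} (g : (Fin k → Fin N) → Euc N → ℝ) (x : Euc N) : ℝ :=
  Real.sqrt (∑ m : Fin k → Fin N, g m x ^ 2)

/-- The pointwise Euclidean norm `|∇u|` of a first-order gradient. -/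
def gradNorm1 {N : ℕ} (g : Fin N → Euc N → ℝ) (x : Euc N) : ℝ :=
  Real.sqrt (∑ i, g i x ^ 2)

/-- The interval `I_{j,p}` of admissible exponents `q`. -/
def Ijp (N j : ℕ) (p : ℝ) : Set ℝ≥0∞ :=
  if p = (N : ℝ) / (j : ℝ) ∧ 1 < N then Set.Ico (ENNReal.ofReal p) ⊤
  else if p < (N : ℝ) / (j : ℝ) then
    Set.Icc (ENNReal.ofReal p) (ENNReal.ofReal ((N : ℝ) * p / ((N : ℝ) - (j : ℝ) * p)))
  else Set.Icc (ENNReal.ofReal p) ⊤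

/-- The average of `u` on the ball `B_ρ`. -/
def ballAvg {N : ℕ} (ρ : ℝ) (u : Euc N → ℝ) : ℝ :=
  (volume (ball (0 : Euc N) ρ)).toReal⁻¹ * ∫ y in ball (0 : Euc N) ρ, u y

/-- The radial symmetrization `u_S(x) = (Nω_N)⁻¹ ∫_{S^{N-1}} u(|x|σ) dσ`. -/
def radialSymmetrization {N : ℕ} (u : Euc N → ℝ) (x : Euc N) : ℝ :=
  ((N : ℝ) * (volume (ball (0 : Euc N) 1)).toReal)⁻¹ *
    ∫ σ : sphere (0 : Euc N) 1, u (‖x‖ • (σ : Euc N)) ∂((volume : Measure (Euc N)).toSphere)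

/-- `u` is radially symmetric: `u x` only depends on `|x|`. -/
def RadSymm {N : ℕ} (u : Euc N → ℝ) : Prop :=
  ∀ x y : Euc N, ‖x‖ = ‖y‖ → u x = u y

/-- Evaluation of a polynomial on `ℝ^N` at a point. -/
def polyEval {N : ℕ} (π : MvPolynomial (Fin N) ℝ) (x : Euc N) : ℝ :=
  MvPolynomial.eval (fun i => x i) π


/-- Tail integral of `(t+1)^(-m-1)`. -/
theorem aux_tail (m : ℝ) (hm : 0 < m) (r : ℝ) (hr : 0 < r) :
    ∫⁻ t in Set.Ioi r, ENNReal.ofReal ((t + 1) ^ (-m - 1))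
      = ENNReal.ofReal ((1 + r) ^ (-m) / m) := by
  have hint : IntegrableOn (fun t : ℝ => (t + 1) ^ (-m - 1)) (Set.Ioi r) :=
    integrableOn_add_rpow_Ioi_of_lt (by linarith) (by linarith)
  rw [← ofReal_integral_eq_lintegral_ofReal hint]
  · congr 1
    have hd : ∀ x ∈ Set.Ici r,
        HasDerivAt (fun t : ℝ => -((t + 1) ^ (-m) / m)) ((x + 1) ^ (-m - 1)) x := by
      intro x hx
      have hx' : r ≤ x := hx
      have h1 : HasDerivAt (fun t : ℝ => t + 1) 1 x := (hasDerivAt_id x).add_const 1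
      have h2 := ((h1.rpow_const (p := -m) (Or.inl (by linarith))).div_const m).neg
      convert! h2 using 1
      field_simp
    have ht : Tendsto (fun t : ℝ => -((t + 1) ^ (-m) / m)) atTop (nhds 0) := by
      have h1 : Tendsto (fun t : ℝ => (t + 1) ^ (-m)) atTop (nhds 0) :=
        (tendsto_rpow_neg_atTop hm).comp (tendsto_atTop_add_const_right _ 1 tendsto_id)
      simpa using (h1.div_const m).neg
    rw [integral_Ioi_of_hasDerivAt_of_tendsto' hd hint ht, add_comm r 1]
    ring
  · filter_upwards [ae_restrict_mem measurableSet_Ioi] with t ht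
    have : r < t := ht
    exact Real.rpow_nonneg (by linarith) _

/-- Integral of `t^(-a)` on `(0,1]`. -/
theorem aux_unit (a : ℝ) (ha : a < 1) :
    ∫⁻ t in Set.Ioc (0:ℝ) 1, ENNReal.ofReal (t ^ (-a)) = ENNReal.ofReal (1 / (1 - a)) := by
  have hint : IntervalIntegrable (fun t : ℝ => t ^ (-a)) volume 0 1 :=
    intervalIntegral.intervalIntegrable_rpow' (by linarith)
  have hint' := (intervalIntegrable_iff_integrableOn_Ioc_of_le zero_le_one).1 hint
  rw [← ofReal_integral_eq_lintegral_ofReal hint',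
    ← intervalIntegral.integral_of_le zero_le_one, integral_rpow (Or.inl (by linarith))]
  · congr 1
    rw [Real.one_rpow, Real.zero_rpow (by linarith)]
    ring_nf
  · filter_upwards [ae_restrict_mem measurableSet_Ioc] with t ht
    exact Real.rpow_nonneg ht.1.le _

/-- The weight integral. -/
theorem aux_weight (a m : ℝ) (ha0 : 0 ≤ a) (ha : a < 1) (hm : 0 < m) (r : ℝ) (hr : 0 < r) :
    ∫⁻ t in Set.Ioi r, ENNReal.ofReal ((1 + t) ^ (a - m - 1) * t ^ (-a))
      ≤ ENNReal.ofReal (2 * (2 ^ m / (1 - a) + 1 / m) * (1 + r) ^ (-m)) := by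
  have h2a : (2:ℝ) ^ a ≤ 2 := by
    calc (2:ℝ) ^ a ≤ 2 ^ (1:ℝ) := Real.rpow_le_rpow_of_exponent_le (by norm_num) ha.le
      _ = 2 := by norm_num
  have hpt : ∀ t ∈ Set.Ioi r, ENNReal.ofReal ((1 + t) ^ (a - m - 1) * t ^ (-a)) ≤
      2 * ((Set.Iic (1:ℝ)).indicator (fun t => ENNReal.ofReal (t ^ (-a))) t
        + ENNReal.ofReal ((t + 1) ^ (-m - 1))) := by
    intro t ht
    have ht0 : 0 < t := hr.trans ht
    have h1t : 0 < 1 + t := by linarith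
    have hsplit : (1 + t) ^ (a - m - 1) = (1 + t) ^ a * (1 + t) ^ (-m - 1) := by
      rw [← Real.rpow_add h1t]; congr 1; ring
    have e2 : (2:ℝ≥0∞) = ENNReal.ofReal 2 := by simp
    by_cases h : t ≤ 1
    · rw [Set.indicator_of_mem (by exact h)]
      refine le_trans ?_ (mul_le_mul_right (le_add_right le_rfl) _)
      rw [e2, ← ENNReal.ofReal_mul (by norm_num)]
      apply ENNReal.ofReal_le_ofReal
      have : (1 + t) ^ (a - m - 1) ≤ 2 := by
        rw [hsplit]
        have h3 : (1 + t) ^ a ≤ 2 := (Real.rpow_le_rpow h1t.le (by linarith) ha0).trans h2a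
        have h4 : (1 + t) ^ (-m - 1) ≤ 1 :=
          Real.rpow_le_one_of_one_le_of_nonpos (by linarith) (by linarith)
        have h5 := Real.rpow_nonneg h1t.le (-m - 1)
        nlinarith
      exact mul_le_mul_of_nonneg_right this (Real.rpow_nonneg ht0.le _)
    · push Not at h
      refine le_trans ?_ (mul_le_mul_right (le_add_left le_rfl) _)
      rw [e2, ← ENNReal.ofReal_mul (by norm_num)]
      apply ENNReal.ofReal_le_ofReal
      rw [hsplit, add_comm t 1]
      have h6 : (1 + t) ^ a * t ^ (-a) ≤ 2 := by
        rw [Real.rpow_neg ht0.le, ← div_eq_mul_inv, ← Real.div_rpow h1t.le ht0.le]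
        refine (Real.rpow_le_rpow (by positivity) ?_ ha0).trans h2a
        rw [div_le_iff₀ ht0]; linarith
      have h5 := Real.rpow_nonneg h1t.le (-m - 1)
      nlinarith
  have hmeas : Measurable fun t : ℝ => ENNReal.ofReal ((t + 1) ^ (-m - 1)) := by fun_prop
  have h1 : ∫⁻ t in Set.Ioi r, (Set.Iic (1:ℝ)).indicator (fun t => ENNReal.ofReal (t ^ (-a))) t
      ≤ ENNReal.ofReal (2 ^ m / (1 - a) * (1 + r) ^ (-m)) := by
    rw [lintegral_indicator measurableSet_Iic, Measure.restrict_restrict measurableSet_Iic]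
    by_cases h : r ≤ 1
    · calc ∫⁻ t in Set.Iic 1 ∩ Set.Ioi r, ENNReal.ofReal (t ^ (-a))
          ≤ ∫⁻ t in Set.Ioc (0:ℝ) 1, ENNReal.ofReal (t ^ (-a)) :=
            lintegral_mono_set (fun t ht => ⟨hr.trans ht.2, ht.1⟩)
        _ = _ := aux_unit a ha
        _ ≤ _ := by
          apply ENNReal.ofReal_le_ofReal
          have h7 : 1 ≤ (2:ℝ) ^ m * (1 + r) ^ (-m) := by
            rw [Real.rpow_neg (by linarith), ← div_eq_mul_inv,
              ← Real.div_rpow (by norm_num) (by linarith)]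
            apply Real.one_le_rpow _ hm.le
            rw [le_div_iff₀ (by linarith)]; linarith
          rw [div_mul_eq_mul_div]
          exact div_le_div_of_nonneg_right h7 (by linarith)
    · have : Set.Iic 1 ∩ Set.Ioi r = ∅ := by
        ext t; simp only [Set.mem_inter_iff, Set.mem_Iic, Set.mem_Ioi, Set.mem_empty_iff_false,
          iff_false]
        intro h'; linarith
      rw [this]; simp
  calc _ ≤ ∫⁻ t in Set.Ioi r, 2 * ((Set.Iic (1:ℝ)).indicator
            (fun t => ENNReal.ofReal (t ^ (-a))) t + ENNReal.ofReal ((t + 1) ^ (-m - 1))) :=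
        setLIntegral_mono' measurableSet_Ioi hpt
    _ = 2 * ((∫⁻ t in Set.Ioi r, (Set.Iic (1:ℝ)).indicator (fun t => ENNReal.ofReal (t ^ (-a))) t)
          + ENNReal.ofReal ((1 + r) ^ (-m) / m)) := by
        rw [lintegral_const_mul' _ _ (by simp), lintegral_add_right _ hmeas, aux_tail m hm r hr]
    _ ≤ 2 * (ENNReal.ofReal (2 ^ m / (1 - a) * (1 + r) ^ (-m))
          + ENNReal.ofReal ((1 + r) ^ (-m) / m)) := by gcongr
    _ = _ := by
        have h8 := Real.rpow_nonneg (show (0:ℝ) ≤ 1 + r by linarith) (-m)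
        have h9 : 0 < 1 - a := by linarith
        rw [← ENNReal.ofReal_add (by positivity) (by positivity),
          show (2:ℝ≥0∞) = ENNReal.ofReal 2 by simp, ← ENNReal.ofReal_mul (by norm_num)]
        congr 1
        ring

/-- Fundamental theorem of calculus bound at infinity. -/
theorem aux_ftc (f f' : ℝ → ℝ) (hf' : LocallyIntegrableOn f' (Set.Ioi 0) volume)
    (hf : ∀ r : ℝ, 0 < r → f r = f 1 + ∫ t in (1:ℝ)..r, f' t)
    (hlim : Tendsto f atTop (nhds 0)) (r : ℝ) (hr : 0 < r) :
    ENNReal.ofReal |f r| ≤ ∫⁻ t in Set.Ioi r, ENNReal.ofReal |f' t| := by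
  have hii : ∀ x y : ℝ, 0 < x → 0 < y → IntervalIntegrable f' volume x y := by
    intro x y hx hy
    apply IntegrableOn.intervalIntegrable
    apply hf'.integrableOn_compact_subset _ isCompact_uIcc
    intro t ht
    exact (lt_min hx hy).trans_le ht.1
  have key : ∀ x, r ≤ x → ENNReal.ofReal |f x - f r| ≤
      ∫⁻ t in Set.Ioi r, ENNReal.ofReal |f' t| := by
    intro x hx
    have hx0 : 0 < x := hr.trans_le hx
    have e : f x - f r = ∫ t in r..x, f' t := by
      rw [hf x hx0, hf r hr, ← intervalIntegral.integral_add_adjacent_intervals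
        (hii 1 r one_pos hr) (hii r x hr hx0)]
      ring
    rw [e, intervalIntegral.integral_of_le hx]
    simp only [← Real.enorm_eq_ofReal_abs]
    exact (enorm_integral_le_lintegral_enorm _).trans
      (lintegral_mono_set Set.Ioc_subset_Ioi_self)
  have ht : Tendsto (fun x => ENNReal.ofReal |f x - f r|) atTop
      (nhds (ENNReal.ofReal |0 - f r|)) :=
    ENNReal.tendsto_ofReal ((hlim.sub_const _).abs)
  have := le_of_tendsto ht ((eventually_ge_atTop r).mono key)
  simpa using this

/-- Lemma 4(ii). For `s < -1` and `N < p < ∞`: a sup-form Hardy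
inequality on `(0,∞)` with constant independent of `R ≥ 0` and of `f`, for locally
absolutely continuous `f` on `(0,∞)` with `f(r) → 0` as `r → ∞`. -/
theorem stmt_6 {N : ℕ} (hN : 1 ≤ N) (s p : ℝ) (hs : s < -1) (hp : 1 ≤ p)
    (hpN : (N : ℝ) < p) :
    ∃ C : ℝ, 0 < C ∧
      ∀ R : ℝ, 0 ≤ R →
      ∀ f f' : ℝ → ℝ, LocallyIntegrableOn f' (Set.Ioi 0) volume →
        (∀ r : ℝ, 0 < r → f r = f 1 + ∫ t in (1:ℝ)..r, f' t) →
        Tendsto f atTop (nhds 0) →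
        (⨆ r ∈ Set.Ioi (0:ℝ) ∩ Set.Ici R, ENNReal.ofReal ((1 + r) ^ (-(s + 1)) * |f r|))
          ≤ ENNReal.ofReal C *
            (∫⁻ r in Set.Ioi R,
              ENNReal.ofReal ((1 + r) ^ (-s * p - N) * r ^ ((N : ℝ) - 1)
                * |f' r| ^ p)) ^ (1 / p) := by
  have hN' : (1:ℝ) ≤ N := by exact_mod_cast hN
  have hp1 : 1 < p := by linarith
  have hp0 : 0 < p := by linarith
  have hpm : 0 < p - 1 := by linarith
  set q : ℝ := p / (p - 1) with hq
  have hq0 : 0 < q := by positivity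
  have hpq : p.HolderConjugate q := Real.HolderConjugate.conjExponent hp1
  set a : ℝ := (N - 1) / (p - 1) with ha
  have ha0 : 0 ≤ a := div_nonneg (by linarith) hpm.le
  have ha1 : a < 1 := by rw [ha, div_lt_one hpm]; linarith
  set m : ℝ := -(s + 1) * q with hm
  have hm0 : 0 < m := mul_pos (by linarith) hq0
  set K : ℝ := 2 * (2 ^ m / (1 - a) + 1 / m) with hK
  have hK0 : 0 < K := by
    have : 0 < 1 - a := by linarith
    positivity
  refine ⟨K ^ (1 / q), by positivity, ?_⟩
  intro R hR f f' hf' hf hlim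
  refine iSup₂_le fun r hr => ?_
  obtain ⟨hr0, hrR⟩ := hr
  have hr0 : 0 < r := hr0
  have hrR : R ≤ r := hrR
  set w : ℝ → ℝ := fun t => (1 + t) ^ (-s * p - N) * t ^ ((N : ℝ) - 1) with hw
  have hwpos : ∀ t, 0 < t → 0 < w t := fun t ht => by
    have : 0 < 1 + t := by linarith
    simp only [hw]; positivity
  have hwm : Measurable w := by simp only [hw]; fun_prop
  have hfm : AEMeasurable f' (volume.restrict (Set.Ioi r)) := by
    have h := hf'.aestronglyMeasurable.aemeasurable
    exact h.mono_measure (Measure.restrict_mono (Set.Ioi_subset_Ioi hr0.le) le_rfl)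
  have hF : AEMeasurable (fun t => ENNReal.ofReal (w t ^ (-(1 / p))))
      (volume.restrict (Set.Ioi r)) := by
    exact (hwm.pow_const _).ennreal_ofReal.aemeasurable
  have hG : AEMeasurable (fun t => ENNReal.ofReal (w t ^ (1 / p) * |f' t|))
      (volume.restrict (Set.Ioi r)) := by
    have h1 : AEMeasurable (fun t => |f' t|) (volume.restrict (Set.Ioi r)) := by
      simpa only [Real.norm_eq_abs] using hfm.norm
    exact ((hwm.pow_const _).aemeasurable.mul h1).ennreal_ofReal
  have hold := ENNReal.lintegral_mul_le_Lp_mul_Lq (volume.restrict (Set.Ioi r)) hpq.symm hF hG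
  have e1 : ∫⁻ t in Set.Ioi r, ENNReal.ofReal |f' t| =
      ∫⁻ t in Set.Ioi r, ((fun t => ENNReal.ofReal (w t ^ (-(1 / p)))) *
        (fun t => ENNReal.ofReal (w t ^ (1 / p) * |f' t|))) t := by
    refine setLIntegral_congr_fun measurableSet_Ioi fun t ht => ?_
    have hwt := hwpos t (hr0.trans ht)
    simp only [Pi.mul_apply]
    rw [← ENNReal.ofReal_mul (by positivity), ← mul_assoc, ← Real.rpow_add hwt]
    simp
  have e2 : ∫⁻ t in Set.Ioi r, ENNReal.ofReal (w t ^ (-(1 / p))) ^ q =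
      ∫⁻ t in Set.Ioi r, ENNReal.ofReal ((1 + t) ^ (a - m - 1) * t ^ (-a)) := by
    refine setLIntegral_congr_fun measurableSet_Ioi fun t ht => ?_
    have ht0 : 0 < t := hr0.trans ht
    have h1t : 0 < 1 + t := by linarith
    have hwt := hwpos t ht0
    rw [ENNReal.ofReal_rpow_of_nonneg (by positivity) hq0.le, ← Real.rpow_mul hwt.le]
    congr 1
    simp only [hw]
    rw [Real.mul_rpow (by positivity) (by positivity), ← Real.rpow_mul h1t.le,
      ← Real.rpow_mul ht0.le]
    congr 2
    · rw [hm, ha, hq]; field_simp; ring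
    · rw [ha, hq]; field_simp
  have e3 : ∫⁻ t in Set.Ioi r, ENNReal.ofReal (w t ^ (1 / p) * |f' t|) ^ p =
      ∫⁻ t in Set.Ioi r, ENNReal.ofReal (w t * |f' t| ^ p) := by
    refine setLIntegral_congr_fun measurableSet_Ioi fun t ht => ?_
    have hwt := hwpos t (hr0.trans ht)
    rw [ENNReal.ofReal_rpow_of_nonneg (by positivity) hp0.le,
      Real.mul_rpow (by positivity) (abs_nonneg _), ← Real.rpow_mul hwt.le,
      one_div_mul_cancel hp0.ne', Real.rpow_one]
  have h1r : 0 < 1 + r := by linarith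
  rw [← e1, e2, e3] at hold
  calc ENNReal.ofReal ((1 + r) ^ (-(s + 1)) * |f r|)
      = ENNReal.ofReal ((1 + r) ^ (-(s + 1))) * ENNReal.ofReal |f r| :=
        ENNReal.ofReal_mul (by positivity)
    _ ≤ ENNReal.ofReal ((1 + r) ^ (-(s + 1))) *
        ((ENNReal.ofReal (K * (1 + r) ^ (-m))) ^ (1 / q) *
          (∫⁻ t in Set.Ioi R, ENNReal.ofReal (w t * |f' t| ^ p)) ^ (1 / p)) := by
        refine mul_le_mul_right (((aux_ftc f f' hf' hf hlim r hr0).trans hold).trans ?_) _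
        refine mul_le_mul' ?_ ?_
        · exact ENNReal.rpow_le_rpow (aux_weight a m ha0 ha1 hm0 r hr0) (by positivity)
        · exact ENNReal.rpow_le_rpow (lintegral_mono_set (Set.Ioi_subset_Ioi hrR))
            (by positivity)
    _ = _ := by
        rw [← mul_assoc, ENNReal.ofReal_rpow_of_nonneg (by positivity) (by positivity),
          ← ENNReal.ofReal_mul (by positivity)]
        congr 2
        rw [Real.mul_rpow hK0.le (by positivity), ← Real.rpow_mul h1r.le, mul_left_comm,
          ← Real.rpow_add h1r, show -(s + 1) + -m * (1 / q) = 0 by rw [hm]; field_simp; ring,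
          Real.rpow_zero, mul_one]

end
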